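/- Let Σ be a valid signature, I an initial object of CwF_Σ with unique morphisms ⟦-⟧_C : I → C, Γ₀ an object of I, and Γ the uniform family of contexts (⟦Γ₀⟧_C)_C. Then the map sending A₀ ∈ Ty_I(Γ₀) to (⟦A₀⟧_C)_C is a bijection between Ty_I(Γ₀) and the uniform families of types over Γ; and for A₀ ∈ Ty_I(Γ₀) with associated uniform family A, the map sending a₀ ∈ Tm_I(Γ₀,A₀) to (⟦a₀⟧_C)_C is a bijection between Tm_I(Γ₀,A₀) and the uniform families of terms of type A. -/

import Mathlib

universe u v w x u' v' w' x'

/-- A category with families (cwf): a category of contexts and substitutions,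
a `Fam`-valued presheaf of types and terms, a chosen terminal object, and
context comprehension. -/
structure CwF where
  Ctx : Type u
  Hom : Ctx → Ctx → Type v
  id : (Γ : Ctx) → Hom Γ Γ
  comp : {Ξ Δ Γ : Ctx} → Hom Δ Γ → Hom Ξ Δ → Hom Ξ Γ
  id_comp : ∀ {Δ Γ : Ctx} (γ : Hom Δ Γ), comp (id Γ) γ = γ
  comp_id : ∀ {Δ Γ : Ctx} (γ : Hom Δ Γ), comp γ (id Δ) = γ
  comp_assoc : ∀ {Θ Ξ Δ Γ : Ctx} (γ : Hom Δ Γ) (δ : Hom Ξ Δ) (ξ : Hom Θ Ξ),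
    comp (comp γ δ) ξ = comp γ (comp δ ξ)
  Ty : Ctx → Type w
  Tm : (Γ : Ctx) → Ty Γ → Type x
  subTy : {Δ Γ : Ctx} → Ty Γ → Hom Δ Γ → Ty Δ
  subTm : {Δ Γ : Ctx} → {A : Ty Γ} → Tm Γ A → (γ : Hom Δ Γ) → Tm Δ (subTy A γ)
  subTy_id : ∀ {Γ : Ctx} (A : Ty Γ), subTy A (id Γ) = A
  subTy_comp : ∀ {Ξ Δ Γ : Ctx} (A : Ty Γ) (γ : Hom Δ Γ) (δ : Hom Ξ Δ),
    subTy A (comp γ δ) = subTy (subTy A γ) δ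
  subTm_id : ∀ {Γ : Ctx} {A : Ty Γ} (a : Tm Γ A), HEq (subTm a (id Γ)) a
  subTm_comp : ∀ {Ξ Δ Γ : Ctx} {A : Ty Γ} (a : Tm Γ A) (γ : Hom Δ Γ) (δ : Hom Ξ Δ),
    HEq (subTm a (comp γ δ)) (subTm (subTm a γ) δ)
  one : Ctx
  bang : (Γ : Ctx) → Hom Γ one
  bang_unique : ∀ {Γ : Ctx} (γ : Hom Γ one), γ = bang Γ
  ext : (Γ : Ctx) → Ty Γ → Ctx
  p : {Γ : Ctx} → (A : Ty Γ) → Hom (ext Γ A) Γ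
  q : {Γ : Ctx} → (A : Ty Γ) → Tm (ext Γ A) (subTy A (p A))
  pair : {Δ Γ : Ctx} → (A : Ty Γ) → (γ : Hom Δ Γ) → Tm Δ (subTy A γ) → Hom Δ (ext Γ A)
  p_pair : ∀ {Δ Γ : Ctx} (A : Ty Γ) (γ : Hom Δ Γ) (a : Tm Δ (subTy A γ)),
    comp (p A) (pair A γ a) = γ
  q_pair : ∀ {Δ Γ : Ctx} (A : Ty Γ) (γ : Hom Δ Γ) (a : Tm Δ (subTy A γ)),
    HEq (subTm (q A) (pair A γ a)) a
  pair_unique : ∀ {Δ Γ : Ctx} (A : Ty Γ) (γ : Hom Δ Γ) (a : Tm Δ (subTy A γ))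
    (δ : Hom Δ (ext Γ A)), comp (p A) δ = γ → HEq (subTm (q A) δ) a → δ = pair A γ a

/-- A strict cwf-morphism: a functor together with a natural transformation of
`Fam`-valued presheaves, preserving the terminal object and context comprehension
on the nose. -/
structure CwFHom (C : CwF.{u, v, w, x}) (D : CwF.{u', v', w', x'}) where
  obj : C.Ctx → D.Ctx
  map : {Δ Γ : C.Ctx} → C.Hom Δ Γ → D.Hom (obj Δ) (obj Γ)
  map_id : ∀ Γ : C.Ctx, map (C.id Γ) = D.id (obj Γ)
  map_comp : ∀ {Ξ Δ Γ : C.Ctx} (γ : C.Hom Δ Γ) (δ : C.Hom Ξ Δ),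
    map (C.comp γ δ) = D.comp (map γ) (map δ)
  mapTy : {Γ : C.Ctx} → C.Ty Γ → D.Ty (obj Γ)
  mapTm : {Γ : C.Ctx} → {A : C.Ty Γ} → C.Tm Γ A → D.Tm (obj Γ) (mapTy A)
  mapTy_sub : ∀ {Δ Γ : C.Ctx} (A : C.Ty Γ) (γ : C.Hom Δ Γ),
    mapTy (C.subTy A γ) = D.subTy (mapTy A) (map γ)
  mapTm_sub : ∀ {Δ Γ : C.Ctx} {A : C.Ty Γ} (a : C.Tm Γ A) (γ : C.Hom Δ Γ),
    HEq (mapTm (C.subTm a γ)) (D.subTm (mapTm a) (map γ))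
  obj_one : obj C.one = D.one
  obj_ext : ∀ {Γ : C.Ctx} (A : C.Ty Γ), obj (C.ext Γ A) = D.ext (obj Γ) (mapTy A)
  map_p : ∀ {Γ : C.Ctx} (A : C.Ty Γ), HEq (map (C.p A)) (D.p (mapTy A))
  map_q : ∀ {Γ : C.Ctx} (A : C.Ty Γ), HEq (mapTm (C.q A)) (D.q (mapTy A))

/-- A "category of cwfs with structure": a collection of objects, each with an
underlying small cwf, together with a predicate singling out which strict
cwf-morphisms of underlying cwfs are structure-preserving morphisms.
The categories `CwF_Σ` of cwfs with a `Σ`-structure are of this shape. -/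
structure SigCat : Type (u + 2) where
  Obj : Type (u + 1)
  cwf : Obj → CwF.{u, u, u, u}
  Mor : (C D : Obj) → CwFHom (cwf C) (cwf D) → Prop

/-- A uniform family of contexts: a choice of context `Γ_C` in each cwf with
structure `C`, preserved on the nose by all structure-preserving morphisms. -/
structure UnifCtx (S : SigCat.{u}) : Type (u + 1) where
  fam : (C : S.Obj) → (S.cwf C).Ctx
  uniform : ∀ {C D : S.Obj} (F : CwFHom (S.cwf C) (S.cwf D)),
    S.Mor C D F → F.obj (fam C) = fam D

/-- A uniform family of types over a uniform family of contexts. -/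
structure UnifTy (S : SigCat.{u}) (Γ : UnifCtx S) : Type (u + 1) where
  fam : (C : S.Obj) → (S.cwf C).Ty (Γ.fam C)
  uniform : ∀ {C D : S.Obj} (F : CwFHom (S.cwf C) (S.cwf D)),
    S.Mor C D F → HEq (F.mapTy (fam C)) (fam D)

/-- A uniform family of terms of a uniform family of types. -/
structure UnifTm (S : SigCat.{u}) (Γ : UnifCtx S) (A : UnifTy S Γ) : Type (u + 1) where
  fam : (C : S.Obj) → (S.cwf C).Tm (Γ.fam C) (A.fam C)
  uniform : ∀ {C D : S.Obj} (F : CwFHom (S.cwf C) (S.cwf D)),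
    S.Mor C D F → HEq (F.mapTm (fam C)) (fam D)

/-- The category of models of the empty signature: `CwF_∅ = CwF`. -/
def SigCat.empty : SigCat.{u} where
  Obj := CwF.{u, u, u, u}
  cwf := fun C => C
  Mor := fun _ _ _ => True

/-- Extending a signature by a new sort symbol `S` relative to a uniform family
of contexts `Γ`: objects are pairs `(C, S_C)` with `S_C ∈ Ty_C(Γ_C)`, and
morphisms are those `F` with `F(S_C) = S_D`. -/
def SigCat.addSort (S : SigCat.{u}) (Γ : UnifCtx S) : SigCat.{u} where
  Obj := Σ C : S.Obj, (S.cwf C).Ty (Γ.fam C)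
  cwf := fun C => S.cwf C.1
  Mor := fun C D F => S.Mor C.1 D.1 F ∧ HEq (F.mapTy C.2) D.2

/-- Extending a signature by a new operator symbol `f` relative to a uniform
family of contexts `Γ` and a uniform family of types `A`: objects are pairs
`(C, f_C)` with `f_C ∈ Tm_C(Γ_C, A_C)`, and morphisms are those `F` with
`F(f_C) = f_D`. -/
def SigCat.addOp (S : SigCat.{u}) (Γ : UnifCtx S) (A : UnifTy S Γ) : SigCat.{u} where
  Obj := Σ C : S.Obj, (S.cwf C).Tm (Γ.fam C) (A.fam C)
  cwf := fun C => S.cwf C.1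
  Mor := fun C D F => S.Mor C.1 D.1 F ∧ HEq (F.mapTm C.2) D.2

/-- Extending a signature by a new equation `a = a'` between uniform families
of terms: the full subcategory of objects `C` with `a_C = a'_C`. -/
def SigCat.addEq (S : SigCat.{u}) (Γ : UnifCtx S) (A : UnifTy S Γ)
    (a a' : UnifTm S Γ A) : SigCat.{u} where
  Obj := { C : S.Obj // a.fam C = a'.fam C }
  cwf := fun C => S.cwf C.1
  Mor := fun C D F => S.Mor C.1 D.1 F

/-- Valid signatures, presented via their categories of models: the inductive
closure of `CwF_∅ = CwF` under extension by sort symbols, operator symbols and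
equations relative to uniform families. -/
inductive SigCat.Valid : SigCat.{u} → Prop
  | empty : SigCat.Valid SigCat.empty
  | addSort (S : SigCat.{u}) (Γ : UnifCtx S) :
      SigCat.Valid S → SigCat.Valid (S.addSort Γ)
  | addOp (S : SigCat.{u}) (Γ : UnifCtx S) (A : UnifTy S Γ) :
      SigCat.Valid S → SigCat.Valid (S.addOp Γ A)
  | addEq (S : SigCat.{u}) (Γ : UnifCtx S) (A : UnifTy S Γ) (a a' : UnifTm S Γ A) :
      SigCat.Valid S → SigCat.Valid (S.addEq Γ A a a')

/-- `I` is an initial object of the category of cwfs with structure `S`: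
to every object there is a unique structure-preserving strict cwf-morphism
from `I`. -/
def SigCat.IsInitial (S : SigCat.{u}) (I : S.Obj) : Prop :=
  ∀ C : S.Obj, ∃! F : CwFHom (S.cwf I) (S.cwf C), S.Mor I C F

theorem CwF.heq_p (D : CwF.{u, v, w, x}) {Γ Γ' : D.Ctx} {A : D.Ty Γ} {A' : D.Ty Γ'}
    (h : Γ = Γ') (hA : HEq A A') : HEq (D.p A) (D.p A') := by
  subst h; cases hA; rfl

theorem CwF.heq_q (D : CwF.{u, v, w, x}) {Γ Γ' : D.Ctx} {A : D.Ty Γ} {A' : D.Ty Γ'}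
    (h : Γ = Γ') (hA : HEq A A') : HEq (D.q A) (D.q A') := by
  subst h; cases hA; rfl

theorem CwFHom.heq_map {C : CwF.{u, v, w, x}} {D : CwF.{u', v', w', x'}} (F : CwFHom C D)
    {Δ Δ' Γ Γ' : C.Ctx} {f : C.Hom Δ Γ} {f' : C.Hom Δ' Γ'}
    (h : Δ = Δ') (h' : Γ = Γ') (hf : HEq f f') : HEq (F.map f) (F.map f') := by
  subst h; subst h'; cases hf; rfl

theorem CwFHom.heq_mapTy {C : CwF.{u, v, w, x}} {D : CwF.{u', v', w', x'}} (F : CwFHom C D)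
    {Γ Γ' : C.Ctx} {A : C.Ty Γ} {A' : C.Ty Γ'}
    (h : Γ = Γ') (hA : HEq A A') : HEq (F.mapTy A) (F.mapTy A') := by
  subst h; cases hA; rfl

theorem CwFHom.heq_mapTm {C : CwF.{u, v, w, x}} {D : CwF.{u', v', w', x'}} (F : CwFHom C D)
    {Γ Γ' : C.Ctx} {A : C.Ty Γ} {A' : C.Ty Γ'} {a : C.Tm Γ A} {a' : C.Tm Γ' A'}
    (h : Γ = Γ') (hA : HEq A A') (ha : HEq a a') : HEq (F.mapTm a) (F.mapTm a') := by
  subst h; cases hA; cases ha; rfl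

/-- The identity strict cwf-morphism. -/
def CwFHom.idHom (C : CwF.{u, v, w, x}) : CwFHom C C where
  obj Γ := Γ
  map f := f
  map_id _ := rfl
  map_comp _ _ := rfl
  mapTy A := A
  mapTm a := a
  mapTy_sub _ _ := rfl
  mapTm_sub _ _ := HEq.rfl
  obj_one := rfl
  obj_ext _ := rfl
  map_p _ := HEq.rfl
  map_q _ := HEq.rfl

/-- Composition of strict cwf-morphisms. -/
def CwFHom.compHom {C D E : CwF.{u, v, w, x}} (G : CwFHom D E) (F : CwFHom C D) :
    CwFHom C E where
  obj Γ := G.obj (F.obj Γ)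
  map f := G.map (F.map f)
  map_id _ := by rw [F.map_id, G.map_id]
  map_comp _ _ := by rw [F.map_comp, G.map_comp]
  mapTy A := G.mapTy (F.mapTy A)
  mapTm a := G.mapTm (F.mapTm a)
  mapTy_sub _ _ := by rw [F.mapTy_sub, G.mapTy_sub]
  mapTm_sub a γ :=
    (G.heq_mapTm rfl (heq_of_eq (F.mapTy_sub _ _)) (F.mapTm_sub a γ)).trans (G.mapTm_sub _ _)
  obj_one := by rw [F.obj_one, G.obj_one]
  obj_ext _ := by rw [F.obj_ext, G.obj_ext]
  map_p A := (G.heq_map (F.obj_ext A) rfl (F.map_p A)).trans (G.map_p _)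
  map_q {Γ} A := by
    refine (G.heq_mapTm (F.obj_ext A) ?_ (F.map_q A)).trans (G.map_q _)
    rw [F.mapTy_sub]
    have h := F.map_p A
    revert h
    generalize F.map (C.p A) = f
    revert f
    rw [F.obj_ext]
    intro f h
    cases h
    rfl

theorem SigCat.Valid.mor_id {S : SigCat.{u}} (hS : S.Valid) :
    ∀ C : S.Obj, S.Mor C C (CwFHom.idHom _) := by
  induction hS with
  | empty => intro C; trivial
  | addSort S Γ _ ih => intro C; exact ⟨ih C.1, HEq.rfl⟩
  | addOp S Γ A _ ih => intro C; exact ⟨ih C.1, HEq.rfl⟩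
  | addEq S Γ A a a' _ ih => intro C; exact ih C.1

theorem SigCat.Valid.mor_comp {S : SigCat.{u}} (hS : S.Valid) :
    ∀ (C D E : S.Obj) (G : CwFHom (S.cwf D) (S.cwf E)) (F : CwFHom (S.cwf C) (S.cwf D)),
      S.Mor D E G → S.Mor C D F → S.Mor C E (G.compHom F) := by
  induction hS with
  | empty => intros; trivial
  | addSort S Γ _ ih =>
    intro C D E G F hG hF
    exact ⟨ih _ _ _ G F hG.1 hF.1,
      (CwFHom.heq_mapTy G (Γ.uniform F hF.1) hF.2).trans hG.2⟩
  | addOp S Γ A _ ih =>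
    intro C D E G F hG hF
    exact ⟨ih _ _ _ G F hG.1 hF.1,
      (CwFHom.heq_mapTm G (Γ.uniform F hF.1) (A.uniform F hF.1) hF.2).trans hG.2⟩
  | addEq S Γ A a a' _ ih =>
    intro C D E G F hG hF
    exact ih _ _ _ G F hG hF

/-- For a valid signature `Σ` with initial object `I`, interpretation
morphisms `⟦-⟧_C : I → C`, and an object `Γ₀` of `I` (inducing the uniform
family `Γ = (⟦Γ₀⟧_C)_C`): the map `A₀ ↦ (⟦A₀⟧_C)_C` is a bijection between
`Ty_I(Γ₀)` and the uniform families of types over `Γ`, and for each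
`A₀ ∈ Ty_I(Γ₀)` the map `a₀ ↦ (⟦a₀⟧_C)_C` is a bijection between
`Tm_I(Γ₀,A₀)` and the uniform families of terms of type `(⟦A₀⟧_C)_C`. -/
theorem initial_ty_tm_bijection (S : SigCat.{u}) (hS : S.Valid)
    (I : S.Obj) (hI : S.IsInitial I)
    (interp : (C : S.Obj) → CwFHom (S.cwf I) (S.cwf C))
    (hinterp : ∀ C : S.Obj, S.Mor I C (interp C))
    (Γ₀ : (S.cwf I).Ctx) :
    -- types: the image families are uniform, the map is injective and surjective
    ((∀ (A₀ : (S.cwf I).Ty Γ₀) {C D : S.Obj} (F : CwFHom (S.cwf C) (S.cwf D)),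
        S.Mor C D F → HEq (F.mapTy ((interp C).mapTy A₀)) ((interp D).mapTy A₀)) ∧
      Function.Injective
        (fun A₀ : (S.cwf I).Ty Γ₀ => fun C : S.Obj => (interp C).mapTy A₀) ∧
      (∀ fam : (C : S.Obj) → (S.cwf C).Ty ((interp C).obj Γ₀),
        (∀ {C D : S.Obj} (F : CwFHom (S.cwf C) (S.cwf D)),
          S.Mor C D F → HEq (F.mapTy (fam C)) (fam D)) →
        ∃ A₀ : (S.cwf I).Ty Γ₀, ∀ C : S.Obj, (interp C).mapTy A₀ = fam C)) ∧
    -- terms: for each type `A₀` of `I`, the image families are uniform, the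
    -- map is injective and surjective
    (∀ A₀ : (S.cwf I).Ty Γ₀,
      (∀ (a₀ : (S.cwf I).Tm Γ₀ A₀) {C D : S.Obj} (F : CwFHom (S.cwf C) (S.cwf D)),
        S.Mor C D F → HEq (F.mapTm ((interp C).mapTm a₀)) ((interp D).mapTm a₀)) ∧
      Function.Injective
        (fun a₀ : (S.cwf I).Tm Γ₀ A₀ => fun C : S.Obj => (interp C).mapTm a₀) ∧
      (∀ fam : (C : S.Obj) → (S.cwf C).Tm ((interp C).obj Γ₀) ((interp C).mapTy A₀),
        (∀ {C D : S.Obj} (F : CwFHom (S.cwf C) (S.cwf D)),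
          S.Mor C D F → HEq (F.mapTm (fam C)) (fam D)) →
        ∃ a₀ : (S.cwf I).Tm Γ₀ A₀, ∀ C : S.Obj, (interp C).mapTm a₀ = fam C)) := by
  have hid : interp I = CwFHom.idHom _ :=
    (hI I).unique (hinterp I) (hS.mor_id I)
  have hcomp : ∀ {C D : S.Obj} (F : CwFHom (S.cwf C) (S.cwf D)), S.Mor C D F →
      F.compHom (interp C) = interp D := fun {C D} F hF =>
    (hI D).unique (hS.mor_comp _ _ _ F (interp C) hF (hinterp C)) (hinterp D)
  have hobj : (interp I).obj Γ₀ = Γ₀ := by rw [hid]; rfl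
  have hTy : ∀ A : (S.cwf I).Ty Γ₀, HEq ((interp I).mapTy A) A := by
    intro A; rw [hid]; rfl
  have hTm : ∀ (A : (S.cwf I).Ty Γ₀) (a : (S.cwf I).Tm Γ₀ A),
      HEq ((interp I).mapTm a) a := by
    intro A a; rw [hid]; rfl
  refine ⟨⟨?_, ?_, ?_⟩, fun A₀ => ⟨?_, ?_, ?_⟩⟩
  · intro A₀ C D F hF
    rw [← hcomp F hF]; rfl
  · intro A B h
    exact eq_of_heq ((hTy A).symm.trans ((heq_of_eq (congrFun h I)).trans (hTy B)))
  · intro fam hfam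
    have : ∃ A₀ : (S.cwf I).Ty Γ₀, HEq A₀ (fam I) := by
      generalize fam I = A
      revert A
      rw [hobj]
      exact fun A => ⟨A, HEq.rfl⟩
    obtain ⟨A₀, hA⟩ := this
    exact ⟨A₀, fun C => eq_of_heq
      (((interp C).heq_mapTy hobj.symm hA).trans (hfam (interp C) (hinterp C)))⟩
  · intro a₀ C D F hF
    rw [← hcomp F hF]; rfl
  · intro a b h
    exact eq_of_heq ((hTm A₀ a).symm.trans ((heq_of_eq (congrFun h I)).trans (hTm A₀ b)))
  · intro fam hfam
    have : ∃ a₀ : (S.cwf I).Tm Γ₀ A₀, HEq a₀ (fam I) := by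
      generalize fam I = a
      revert a
      rw [hid]
      exact fun a => ⟨a, HEq.rfl⟩
    obtain ⟨a₀, ha⟩ := this
    exact ⟨a₀, fun C => eq_of_heq
      (((interp C).heq_mapTm hobj.symm (hTy A₀).symm ha).trans
        (hfam (interp C) (hinterp C)))⟩
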